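/- arXiv:1911.00296 — 3 statements merged into one kernel-verified Lean document; each statement's English description precedes it below -/
import Mathlib

section
/- Let R be a commutative ring, A a commutative R-algebra, V an R-module, α and β alternating 2-forms on V with values in A, and m₁, m₂, m₃ ∈ R. Let f : V →ₗ[R] V × V × V be the linear map v ↦ (m₁ • v, m₂ • v, m₃ • v), and for i ∈ {1,2,3} let αᵢ (resp. βᵢ) denote the pullback of α (resp. β) along the i-th projection V × V × V → V. Then the pullback of the 4-form (α₁ + α₂ + α₃) ∧ (β₁ + β₂ + β₃) along f equals (m₁² + m₂² + m₃²)² • (α ∧ β). -/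
open scoped TensorProduct

/-- The wedge product of two alternating 2-forms on an `R`-module `V` with values in a
commutative `R`-algebra `A`: the alternating 4-form
`(α ∧ β)(v₁,v₂,v₃,v₄) = Σ ε(i,j,k,l) · α(v_i,v_j) · β(v_k,v_l)`, obtained from
`AlternatingMap.domCoprod` composed with the multiplication `A ⊗[R] A → A` and
reindexed along `Fin 2 ⊕ Fin 2 ≃ Fin 4`. -/
noncomputable def wedge {R A V : Type*} [CommRing R] [CommRing A] [Algebra R A]
    [AddCommGroup V] [Module R V]
    (α β : AlternatingMap R V A (Fin 2)) : AlternatingMap R V A (Fin 4) :=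
  AlternatingMap.domDomCongr finSumFinEquiv
    ((LinearMap.mul' R A).compAlternatingMap (AlternatingMap.domCoprod α β))

theorem AlternatingMap.domCoprod_compLinearMap {R M M' N₁ N₂ ι₁ ι₂ : Type*} [CommRing R]
    [AddCommGroup M] [Module R M] [AddCommGroup M'] [Module R M']
    [AddCommGroup N₁] [Module R N₁] [AddCommGroup N₂] [Module R N₂]
    [Fintype ι₁] [Fintype ι₂] [DecidableEq ι₁] [DecidableEq ι₂]
    (a : AlternatingMap R M N₁ ι₁) (b : AlternatingMap R M N₂ ι₂) (f : M' →ₗ[R] M) :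
    (a.domCoprod b).compLinearMap f = (a.compLinearMap f).domCoprod (b.compLinearMap f) := by
  ext v
  simp only [AlternatingMap.compLinearMap_apply, AlternatingMap.domCoprod_apply,
    sum_apply]
  refine Finset.sum_congr rfl fun σ _ => ?_
  induction σ using Quotient.inductionOn' with
  | h σ => rfl

theorem wedge_compLinearMap {R A V W : Type*} [CommRing R] [CommRing A] [Algebra R A]
    [AddCommGroup V] [Module R V] [AddCommGroup W] [Module R W]
    (α β : AlternatingMap R V A (Fin 2)) (f : W →ₗ[R] V) :
    (wedge α β).compLinearMap f = wedge (α.compLinearMap f) (β.compLinearMap f) := by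
  simp only [wedge, ← AlternatingMap.domCoprod_compLinearMap]
  rfl

theorem wedge_smul_smul {R A V : Type*} [CommRing R] [CommRing A] [Algebra R A]
    [AddCommGroup V] [Module R V] (a b : R) (α β : AlternatingMap R V A (Fin 2)) :
    wedge (a • α) (b • β) = (a * b) • wedge α β := by
  have h : (a • α).domCoprod (b • β) = (a * b) • α.domCoprod β := by
    simp only [← AlternatingMap.domCoprod'_apply, TensorProduct.smul_tmul_smul, map_smul]
  ext v
  simp [wedge, h]

/-- The pullback of a sum of 2-forms on the three factors along `v ↦ (m₁ • v, m₂ • v, m₃ • v)`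
multiplies the form by `m₁² + m₂² + m₃²`. -/
theorem sum_projections_compLinearMap_smul {R A V : Type*} [CommRing R]
    [AddCommGroup A] [Module R A] [AddCommGroup V] [Module R V]
    (α : AlternatingMap R V A (Fin 2)) (m₁ m₂ m₃ : R) :
    (α.compLinearMap (LinearMap.fst R V (V × V)) +
        α.compLinearMap ((LinearMap.fst R V V) ∘ₗ (LinearMap.snd R V (V × V))) +
        α.compLinearMap ((LinearMap.snd R V V) ∘ₗ (LinearMap.snd R V (V × V)))).compLinearMap
      ((m₁ • (LinearMap.id : V →ₗ[R] V)).prod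
        ((m₂ • (LinearMap.id : V →ₗ[R] V)).prod (m₃ • (LinearMap.id : V →ₗ[R] V)))) =
      (m₁ ^ 2 + m₂ ^ 2 + m₃ ^ 2) • α := by
  have h (m : R) (v : Fin 2 → V) : α (fun i => m • v i) = m ^ 2 • α v := by
    simpa using α.toMultilinearMap.map_smul_univ (fun _ => m) v
  ext v
  simp [h, add_smul]

/-- with `αᵢ`, `βᵢ` the pullbacks of alternating 2-forms `α`, `β` along the
`i`-th projection `V × V × V → V`, the pullback of `(α₁+α₂+α₃) ∧ (β₁+β₂+β₃)` along the
map `f : v ↦ (m₁ • v, m₂ • v, m₃ • v)` is `(m₁² + m₂² + m₃²)² • (α ∧ β)`. -/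
theorem pullback_wedge_sum_of_projections_along_diagonal_scaling
    {R A V : Type*} [CommRing R] [CommRing A] [Algebra R A]
    [AddCommGroup V] [Module R V]
    (α β : AlternatingMap R V A (Fin 2)) (m₁ m₂ m₃ : R) :
    (wedge
        (α.compLinearMap (LinearMap.fst R V (V × V)) +
          α.compLinearMap ((LinearMap.fst R V V) ∘ₗ (LinearMap.snd R V (V × V))) +
          α.compLinearMap ((LinearMap.snd R V V) ∘ₗ (LinearMap.snd R V (V × V))))
        (β.compLinearMap (LinearMap.fst R V (V × V)) +
          β.compLinearMap ((LinearMap.fst R V V) ∘ₗ (LinearMap.snd R V (V × V))) +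
          β.compLinearMap ((LinearMap.snd R V V) ∘ₗ (LinearMap.snd R V (V × V))))).compLinearMap
        ((m₁ • (LinearMap.id : V →ₗ[R] V)).prod
          ((m₂ • (LinearMap.id : V →ₗ[R] V)).prod (m₃ • (LinearMap.id : V →ₗ[R] V)))) =
      ((m₁ ^ 2 + m₂ ^ 2 + m₃ ^ 2) ^ 2) • wedge α β := by
  rw [wedge_compLinearMap, sum_projections_compLinearMap_smul, sum_projections_compLinearMap_smul,
    wedge_smul_smul, ← sq]
end

section
/- Let R be a commutative ring, A a commutative R-algebra, V an R-module, and α, β alternating 2-forms on V with values in A. For i ∈ {1,2,3} let αᵢ (resp. βᵢ) denote the pullback of α (resp. β) along the i-th projection V × V × V → V, and set Ω := (α₁ + α₂ + α₃) ∧ (β₁ + β₂ + β₃). Let f₁, f₂, f₃ : V →ₗ[R] V × V × V be the linear maps f₁(v) = (v, 0, −v), f₂(v) = (0, v, −v), f₃(v) = (v, v, −2v). Then 3 • (Ω.compLinearMap f₁) + 3 • (Ω.compLinearMap f₂) − Ω.compLinearMap f₃ = (−12 : ℤ) • (α ∧ β). -/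
open scoped TensorProduct

/-- The wedge product of alternating 2-forms is compatible with integer scalars. -/
theorem wedge_zsmul_zsmul {R A V : Type*} [CommRing R] [CommRing A] [Algebra R A]
    [AddCommGroup V] [Module R V] (α β : AlternatingMap R V A (Fin 2)) (m n : ℤ) :
    wedge (m • α) (n • β) = (m * n) • wedge α β := by
  have h : AlternatingMap.domCoprod (m • α) (n • β) =
      (m * n) • AlternatingMap.domCoprod α β := by
    let B := (TensorProduct.mk R (AlternatingMap R V A (Fin 2))
      (AlternatingMap R V A (Fin 2))).compr₂ AlternatingMap.domCoprod'
    change B (m • α) (n • β) = (m * n) • B α β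
    rw [map_zsmul, map_zsmul, LinearMap.smul_apply, smul_smul, mul_comm]
  ext v
  simp [wedge, h]

/-- Pulling back an alternating `k`-form along multiplication by `n` multiplies it by `n ^ k`. -/
theorem AlternatingMap.compLinearMap_zsmul_id {R A V : Type*} [CommRing R] [AddCommGroup A]
    [Module R A] [AddCommGroup V] [Module R V] {k : ℕ}
    (γ : AlternatingMap R V A (Fin k)) (n : ℤ) :
    γ.compLinearMap (n • LinearMap.id) = n ^ k • γ := by
  ext v
  have h := γ.map_smul_univ (fun _ => (n : R)) v
  simp only [Int.cast_smul_eq_zsmul, Finset.prod_const, Finset.card_univ, Fintype.card_fin,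
    ← Int.cast_pow] at h
  exact h

/-- The sum of the pullbacks of a 2-form `γ` along the three projections `V × V × V → V` pulls
back to `(a ^ 2 + b ^ 2 + c ^ 2) • γ` along `v ↦ (a • v, b • v, c • v)`. -/
theorem sum_proj_compLinearMap_prod_zsmul {R A V : Type*} [CommRing R] [AddCommGroup A]
    [Module R A] [AddCommGroup V] [Module R V]
    (γ : AlternatingMap R V A (Fin 2)) {f : V →ₗ[R] V × V × V} (a b c : ℤ)
    (hf : ∀ v, f v = (a • v, b • v, c • v)) :
    (γ.compLinearMap (LinearMap.fst R V (V × V)) +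
      γ.compLinearMap ((LinearMap.fst R V V) ∘ₗ (LinearMap.snd R V (V × V))) +
      γ.compLinearMap ((LinearMap.snd R V V) ∘ₗ (LinearMap.snd R V (V × V)))).compLinearMap f =
      (a ^ 2 + b ^ 2 + c ^ 2) • γ := by
  rw [add_smul, add_smul, ← γ.compLinearMap_zsmul_id a, ← γ.compLinearMap_zsmul_id b,
    ← γ.compLinearMap_zsmul_id c]
  ext v
  simp [hf]

/-- with `Ω := (α₁+α₂+α₃) ∧ (β₁+β₂+β₃)` on `V × V × V` and the maps
`f₁(v) = (v,0,-v)`, `f₂(v) = (0,v,-v)`, `f₃(v) = (v,v,-2v)`, one has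
`3 • f₁*Ω + 3 • f₂*Ω - f₃*Ω = -12 • (α ∧ β)`.  This is the form-level content of the
identity `∫ (3([A×0]+[0×A]) - [Δ_A]) · η ∧ η̄ = -12` of Proposition 2. -/
theorem three_smul_pullbacks_sub_diagonal_pullback_eq_neg_twelve_smul_wedge
    {R A V : Type*} [CommRing R] [CommRing A] [Algebra R A]
    [AddCommGroup V] [Module R V]
    (α β : AlternatingMap R V A (Fin 2)) :
    (let α₁ := α.compLinearMap (LinearMap.fst R V (V × V))
     let α₂ := α.compLinearMap ((LinearMap.fst R V V) ∘ₗ (LinearMap.snd R V (V × V)))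
     let α₃ := α.compLinearMap ((LinearMap.snd R V V) ∘ₗ (LinearMap.snd R V (V × V)))
     let β₁ := β.compLinearMap (LinearMap.fst R V (V × V))
     let β₂ := β.compLinearMap ((LinearMap.fst R V V) ∘ₗ (LinearMap.snd R V (V × V)))
     let β₃ := β.compLinearMap ((LinearMap.snd R V V) ∘ₗ (LinearMap.snd R V (V × V)))
     let Ω := wedge (α₁ + α₂ + α₃) (β₁ + β₂ + β₃)
     let f₁ : V →ₗ[R] V × V × V :=
       (LinearMap.id : V →ₗ[R] V).prod ((0 : V →ₗ[R] V).prod (-(LinearMap.id : V →ₗ[R] V)))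
     let f₂ : V →ₗ[R] V × V × V :=
       (0 : V →ₗ[R] V).prod ((LinearMap.id : V →ₗ[R] V).prod (-(LinearMap.id : V →ₗ[R] V)))
     let f₃ : V →ₗ[R] V × V × V :=
       (LinearMap.id : V →ₗ[R] V).prod ((LinearMap.id : V →ₗ[R] V).prod
         ((-2 : ℤ) • (LinearMap.id : V →ₗ[R] V)))
     3 • Ω.compLinearMap f₁ + 3 • Ω.compLinearMap f₂ - Ω.compLinearMap f₃) =
      (-12 : ℤ) • wedge α β := by
  dsimp only
  simp only [wedge_compLinearMap]
  rw [sum_proj_compLinearMap_prod_zsmul α 1 0 (-1) (by simp),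
    sum_proj_compLinearMap_prod_zsmul β 1 0 (-1) (by simp),
    sum_proj_compLinearMap_prod_zsmul α 0 1 (-1) (by simp),
    sum_proj_compLinearMap_prod_zsmul β 0 1 (-1) (by simp),
    sum_proj_compLinearMap_prod_zsmul α 1 1 (-2) (by simp [ofNat_zsmul]),
    sum_proj_compLinearMap_prod_zsmul β 1 1 (-2) (by simp [ofNat_zsmul])]
  simp only [wedge_zsmul_zsmul]
  module
end

section
/- Let R be a commutative ring, A a commutative R-algebra, V, W₁, W₂ R-modules, and α, β alternating 2-forms on V with values in A. Let g₁ : W₁ →ₗ[R] V and g₂ : W₂ →ₗ[R] V be linear maps such that α(g₁x, g₁x') = 0 and β(g₁x, g₁x') = 0 for all x, x' ∈ W₁, and α(g₂y, g₂y') = 0 and β(g₂y, g₂y') = 0 for all y, y' ∈ W₂. Let h : W₁ × W₂ →ₗ[R] V × V × V be the linear map (x, y) ↦ (g₁x, g₂y, g₁x + g₂y). For i ∈ {1,2,3} let αᵢ (resp. βᵢ) denote the pullback of α (resp. β) along the i-th projection V × V × V → V, and set Ω := (α₁ + α₂ + α₃) ∧ (β₁ + β₂ + β₃). Then the pullback of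 Ω along h equals the wedge product a ∧ b, where a is the alternating 2-form on W₁ × W₂ given by a((x,y),(x',y')) = α(g₁x, g₂y') + α(g₂y, g₁x') and b is given by b((x,y),(x',y')) = β(g₁x, g₂y') + β(g₂y, g₁x'). -/
open scoped TensorProduct

/-- A 2-form vanishing on the images of `g₁` and `g₂`, summed over the three projections,
pulls back along `(x, y) ↦ (g₁ x, g₂ y, g₁ x + g₂ y)` to its cross terms. -/
theorem sum_proj_pullback_sum_graph_apply {R A V W₁ W₂ : Type*} [CommRing R] [CommRing A]
    [Algebra R A] [AddCommGroup V] [Module R V] [AddCommGroup W₁] [Module R W₁]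
    [AddCommGroup W₂] [Module R W₂] (α : AlternatingMap R V A (Fin 2))
    (g₁ : W₁ →ₗ[R] V) (g₂ : W₂ →ₗ[R] V)
    (hα₁ : ∀ x x' : W₁, α ![g₁ x, g₁ x'] = 0) (hα₂ : ∀ y y' : W₂, α ![g₂ y, g₂ y'] = 0)
    (a : AlternatingMap R (W₁ × W₂) A (Fin 2))
    (ha : ∀ p q : W₁ × W₂, a ![p, q] = α ![g₁ p.1, g₂ q.2] + α ![g₂ p.2, g₁ q.1]) :
    (α.compLinearMap (LinearMap.fst R V (V × V)) +
        α.compLinearMap ((LinearMap.fst R V V) ∘ₗ (LinearMap.snd R V (V × V))) +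
        α.compLinearMap ((LinearMap.snd R V V) ∘ₗ (LinearMap.snd R V (V × V)))).compLinearMap
      ((g₁ ∘ₗ LinearMap.fst R W₁ W₂).prod
        ((g₂ ∘ₗ LinearMap.snd R W₁ W₂).prod
          (g₁ ∘ₗ LinearMap.fst R W₁ W₂ + g₂ ∘ₗ LinearMap.snd R W₁ W₂))) = a := by
  have eval_pair (u : Fin 2 → V) : α u = α ![u 0, u 1] :=
    congrArg α (by ext i; fin_cases i <;> rfl)
  have add_left (x y z : V) : α ![x + y, z] = α ![x, z] + α ![y, z] :=
    α.toMultilinearMap.cons_add ![z] x y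
  have add_right (x y z : V) : α ![x, y + z] = α ![x, y] + α ![x, z] := by
    have update_one (w : V) : Function.update ![x, 0] 1 w = ![x, w] := by
      ext i; fin_cases i <;> rfl
    simpa only [update_one] using α.map_update_add ![x, 0] 1 y z
  ext v
  have hv : v = ![v 0, v 1] := by ext i <;> fin_cases i <;> rfl
  conv_rhs => rw [hv, ha]
  change α (fun i => g₁ (v i).1) + α (fun i => g₂ (v i).2) +
    α (fun i => g₁ (v i).1 + g₂ (v i).2) = _
  rw [eval_pair fun i => g₁ (v i).1, eval_pair fun i => g₂ (v i).2,
    eval_pair fun i => g₁ (v i).1 + g₂ (v i).2]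
  simp [add_left, add_right, hα₁, hα₂]

/-- if `α` and `β` vanish on the images of `g₁ : W₁ →ₗ[R] V` and
`g₂ : W₂ →ₗ[R] V`, then the pullback of `Ω := (α₁+α₂+α₃) ∧ (β₁+β₂+β₃)` along
`h : (x, y) ↦ (g₁x, g₂y, g₁x + g₂y)` equals `a ∧ b`, where
`a((x,y),(x',y')) = α(g₁x, g₂y') + α(g₂y, g₁x')` and
`b((x,y),(x',y')) = β(g₁x, g₂y') + β(g₂y, g₁x')`. -/
theorem pullback_wedge_along_sum_graph_eq_wedge_of_cross_terms
    {R A V W₁ W₂ : Type*} [CommRing R] [CommRing A] [Algebra R A]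
    [AddCommGroup V] [Module R V] [AddCommGroup W₁] [Module R W₁]
    [AddCommGroup W₂] [Module R W₂]
    (α β : AlternatingMap R V A (Fin 2))
    (g₁ : W₁ →ₗ[R] V) (g₂ : W₂ →ₗ[R] V)
    (hα₁ : ∀ x x' : W₁, α ![g₁ x, g₁ x'] = 0)
    (hβ₁ : ∀ x x' : W₁, β ![g₁ x, g₁ x'] = 0)
    (hα₂ : ∀ y y' : W₂, α ![g₂ y, g₂ y'] = 0)
    (hβ₂ : ∀ y y' : W₂, β ![g₂ y, g₂ y'] = 0)
    (a b : AlternatingMap R (W₁ × W₂) A (Fin 2))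
    (ha : ∀ p q : W₁ × W₂, a ![p, q] = α ![g₁ p.1, g₂ q.2] + α ![g₂ p.2, g₁ q.1])
    (hb : ∀ p q : W₁ × W₂, b ![p, q] = β ![g₁ p.1, g₂ q.2] + β ![g₂ p.2, g₁ q.1]) :
    (wedge
        (α.compLinearMap (LinearMap.fst R V (V × V)) +
          α.compLinearMap ((LinearMap.fst R V V) ∘ₗ (LinearMap.snd R V (V × V))) +
          α.compLinearMap ((LinearMap.snd R V V) ∘ₗ (LinearMap.snd R V (V × V))))
        (β.compLinearMap (LinearMap.fst R V (V × V)) +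
          β.compLinearMap ((LinearMap.fst R V V) ∘ₗ (LinearMap.snd R V (V × V))) +
          β.compLinearMap ((LinearMap.snd R V V) ∘ₗ (LinearMap.snd R V (V × V))))).compLinearMap
        ((g₁ ∘ₗ LinearMap.fst R W₁ W₂).prod
          ((g₂ ∘ₗ LinearMap.snd R W₁ W₂).prod
            (g₁ ∘ₗ LinearMap.fst R W₁ W₂ + g₂ ∘ₗ LinearMap.snd R W₁ W₂))) =
      wedge a b := by
  rw [wedge_compLinearMap, sum_proj_pullback_sum_graph_apply α g₁ g₂ hα₁ hα₂ a ha,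
    sum_proj_pullback_sum_graph_apply β g₁ g₂ hβ₁ hβ₂ b hb]
end
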